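/- Fix integers l ≥ 1 and e ≥ 2, let s ∈ S_e, let (λ,s) be cylindric and not FLOTW with first pseudoperiod P(λ) of width α, and write μ = ψ(λ), charged by ξ(s) = (s_l − e, s_1, …, s_{l−1}). Then: (1) if Γ = (A,B,C) is a node of μ lying in a part μ^C_A > α and γ is the node of λ canonically associated to Γ, then cont_μ(Γ) = cont_λ(γ) when C > 1, and cont_μ(Γ) = cont_λ(γ) − e when C = 1; (2) if Γ = (A,B,C) is a node of μ lying in a part μ^C_A ≤ α and γ is its canonically associated node in λ, then cont_μ(Γ) = cont_λ(γ). (Contents of μ are computed with the multicharge ξ(s), contents of λ with s.) -/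

import Mathlib

namespace FockCrystal

/-- A partition: `part a` is the `a`-th part, for `a ≥ 1`; `part 0` is a dummy value `0`. -/
structure Partition where
  part : ℕ → ℕ
  part_zero : part 0 = 0
  antitone : ∀ a : ℕ, 1 ≤ a → part (a + 1) ≤ part a
  eventually_zero : ∃ N : ℕ, ∀ a : ℕ, N ≤ a → part a = 0

/-- A multipartition with `l + 1` components. -/
abbrev MultiPartition (l : ℕ) := Fin (l + 1) → Partition

/-- A node `(a, b, c)`: row `a ≥ 1`, column `b ≥ 1`, component `c`. -/
structure Node (l : ℕ) where
  row : ℕ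
  col : ℕ
  comp : Fin (l + 1)

variable {l : ℕ}

def IsNode (Λ : MultiPartition l) (γ : Node l) : Prop :=
  1 ≤ γ.row ∧ 1 ≤ γ.col ∧ γ.col ≤ (Λ γ.comp).part γ.row

/-- The content `b − a + s_c` of a node. -/
def content (s : Fin (l + 1) → ℤ) (γ : Node l) : ℤ :=
  (γ.col : ℤ) - (γ.row : ℤ) + s γ.comp

/-- `γ` is a removable node of `Λ`. -/
def Removable (Λ : MultiPartition l) (γ : Node l) : Prop :=
  1 ≤ γ.row ∧ 1 ≤ γ.col ∧ γ.col = (Λ γ.comp).part γ.row ∧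
    (Λ γ.comp).part (γ.row + 1) < (Λ γ.comp).part γ.row

/-- `γ` is an addable node of `Λ`. -/
def Addable (Λ : MultiPartition l) (γ : Node l) : Prop :=
  1 ≤ γ.row ∧ γ.col = (Λ γ.comp).part γ.row + 1 ∧
    (γ.row = 1 ∨ (Λ γ.comp).part γ.row < (Λ γ.comp).part (γ.row - 1))

/-- The strict order `≺_s` on nodes. -/
def NodeLt (s : Fin (l + 1) → ℤ) (γ γ' : Node l) : Prop :=
  content s γ < content s γ' ∨ (content s γ = content s γ' ∧ γ'.comp < γ.comp)

inductive Letter | A | R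
  deriving DecidableEq

/-- The letter attached to a node is `A` iff the node is addable, `R` iff removable. -/
def LetterOk (Λ : MultiPartition l) (p : Node l × Letter) : Prop :=
  (p.2 = Letter.A ↔ Addable Λ p.1) ∧ (p.2 = Letter.R ↔ Removable Λ p.1)

/-- `w` is the `i`-word of `(Λ, s)` for the residue-mod-`e` structure: the list of
addable/removable nodes of residue `i`, in increasing `≺_s`-order, with letters A/R. -/
def IsWordE (Λ : MultiPartition l) (s : Fin (l + 1) → ℤ) (e : ℕ) (i : ℤ)
    (w : List (Node l × Letter)) : Prop :=
  w.Pairwise (fun p q => NodeLt s p.1 q.1) ∧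
  (∀ γ : Node l, (∃ x, (γ, x) ∈ w) ↔
      ((Addable Λ γ ∨ Removable Λ γ) ∧ content s γ % (e : ℤ) = i)) ∧
  ∀ p ∈ w, LetterOk Λ p

/-- `w` is the `j`-word of `(Λ, s)` for the `e = ∞` structure: the list of
addable/removable nodes of content `j`, in increasing `≺_s`-order, with letters A/R. -/
def IsWordInf (Λ : MultiPartition l) (s : Fin (l + 1) → ℤ) (j : ℤ)
    (w : List (Node l × Letter)) : Prop :=
  w.Pairwise (fun p q => NodeLt s p.1 q.1) ∧
  (∀ γ : Node l, (∃ x, (γ, x) ∈ w) ↔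
      ((Addable Λ γ ∨ Removable Λ γ) ∧ content s γ = j)) ∧
  ∀ p ∈ w, LetterOk Λ p

/-- Recursive cancellation of all factors `RA` in a word (of nodes with letters). -/
def reduceW : List (Node l × Letter) → List (Node l × Letter)
  | [] => []
  | p :: ps =>
    match reduceW ps with
    | [] => [p]
    | q :: qs => if p.2 = Letter.R ∧ q.2 = Letter.A then qs else p :: q :: qs

/-- `γ` is the node encoded by the rightmost `A` of the reduced word of `w`. -/
def GoodAddableWord (w : List (Node l × Letter)) (γ : Node l) : Prop :=
  ∃ u v, reduceW w = u ++ (γ, Letter.A) :: v ∧ ∀ p ∈ v, p.2 = Letter.R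

/-- `γ` is the node encoded by the leftmost `R` of the reduced word of `w`. -/
def GoodRemovableWord (w : List (Node l × Letter)) (γ : Node l) : Prop :=
  ∃ u v, reduceW w = u ++ (γ, Letter.R) :: v ∧ ∀ p ∈ u, p.2 = Letter.A

/-- `γ` is the good addable `i`-node of `(Λ, s)` for the residue-mod-`e` structure. -/
def GoodAddable (Λ : MultiPartition l) (s : Fin (l + 1) → ℤ) (e : ℕ) (i : ℤ)
    (γ : Node l) : Prop :=
  ∃ w, IsWordE Λ s e i w ∧ GoodAddableWord w γ

/-- `γ` is the good removable `i`-node of `(Λ, s)` for the residue-mod-`e` structure. -/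
def GoodRemovable (Λ : MultiPartition l) (s : Fin (l + 1) → ℤ) (e : ℕ) (i : ℤ)
    (γ : Node l) : Prop :=
  ∃ w, IsWordE Λ s e i w ∧ GoodRemovableWord w γ

/-- `γ` is the good addable `j`-node of `(Λ, s)` for the `e = ∞` structure. -/
def GoodAddableInf (Λ : MultiPartition l) (s : Fin (l + 1) → ℤ) (j : ℤ)
    (γ : Node l) : Prop :=
  ∃ w, IsWordInf Λ s j w ∧ GoodAddableWord w γ

/-- `Λ'` is obtained from `Λ` by adding the node `γ`. -/
def AddNode (Λ Λ' : MultiPartition l) (γ : Node l) : Prop :=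
  (Λ' γ.comp).part γ.row = (Λ γ.comp).part γ.row + 1 ∧
  (∀ a : ℕ, a ≠ γ.row → (Λ' γ.comp).part a = (Λ γ.comp).part a) ∧
  ∀ c, c ≠ γ.comp → Λ' c = Λ c

/-- `s ∈ S_e`: `0 ≤ s_c − s_{c'} < e` whenever `c' < c`. -/
def InSe (e : ℕ) (s : Fin (l + 1) → ℤ) : Prop :=
  ∀ c' c : Fin (l + 1), c' < c → 0 ≤ s c - s c' ∧ s c - s c' < (e : ℤ)

/-- `s ∈ D_e`: `0 ≤ s_1 ≤ … ≤ s_l < e`. -/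
def InDe (e : ℕ) (s : Fin (l + 1) → ℤ) : Prop :=
  (∀ c, 0 ≤ s c ∧ s c < (e : ℤ)) ∧ Monotone s

/-- The rotation `c ↦ c + 1` of components. -/
def rho (l : ℕ) : Equiv.Perm (Fin (l + 1)) := finRotate (l + 1)

/-- The cyclage on multicharges: `ξ(s) = (s_l − e, s_1, …, s_{l−1})`. -/
def xiCharge (e : ℕ) (s : Fin (l + 1) → ℤ) : Fin (l + 1) → ℤ :=
  fun c => s ((rho l).symm c) - if c = 0 then (e : ℤ) else 0

/-- The cyclage on multipartitions: `ξ(λ) = (λ^l, λ^1, …, λ^{l−1})`. -/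
def xiMP (Λ : MultiPartition l) : MultiPartition l := fun c => Λ ((rho l).symm c)

/-- The corresponding bijection on nodes: `(a,b,c) ↦ (a,b,c+1)` cyclically. -/
def xiNode (γ : Node l) : Node l := ⟨γ.row, γ.col, rho l γ.comp⟩

/-- The component preceding `c` (cyclically). -/
def prevComp {l : ℕ} (c : Fin (l + 1)) : Fin (l + 1) := (rho l).symm c

/-- `(Λ, s)` is cylindric. -/
def Cylindric (e : ℕ) (s : Fin (l + 1) → ℤ) (Λ : MultiPartition l) : Prop :=
  (∀ c : Fin l, ∀ a : ℕ, 1 ≤ a →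
      (Λ c.succ).part (a + (s c.succ - s c.castSucc).toNat) ≤ (Λ c.castSucc).part a) ∧
  ∀ a : ℕ, 1 ≤ a →
      (Λ 0).part (a + ((e : ℤ) + s 0 - s (Fin.last l)).toNat) ≤ (Λ (Fin.last l)).part a

/-- `γ` is the rightmost node of a part of `Λ` of size `α`. -/
def RightmostAt (Λ : MultiPartition l) (α : ℕ) (γ : Node l) : Prop :=
  1 ≤ γ.row ∧ γ.col = α ∧ (Λ γ.comp).part γ.row = α

/-- The residues of the rightmost nodes of the parts of size `α` cover `{0,…,e−1}`. -/
def Covers (e : ℕ) (s : Fin (l + 1) → ℤ) (Λ : MultiPartition l) (α : ℕ) : Prop :=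
  ∀ r : ℤ, 0 ≤ r → r < (e : ℤ) →
    ∃ γ : Node l, RightmostAt Λ α γ ∧ content s γ % (e : ℤ) = r

/-- `(Λ, s)` is FLOTW. -/
def FLOTW (e : ℕ) (s : Fin (l + 1) → ℤ) (Λ : MultiPartition l) : Prop :=
  Cylindric e s Λ ∧ ∀ α : ℕ, 1 ≤ α → ¬ Covers e s Λ α

/-- `P 0, …, P (e−1)` is the first pseudoperiod of `(Λ, s)`, of width `α`. -/
def IsFirstPseudoperiod (e : ℕ) (s : Fin (l + 1) → ℤ) (Λ : MultiPartition l)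
    (α : ℕ) (P : ℕ → Node l) : Prop :=
  1 ≤ α ∧ Covers e s Λ α ∧ (∀ β : ℕ, α < β → ¬ Covers e s Λ β) ∧
  (∀ i, i < e → RightmostAt Λ α (P i)) ∧
  (∀ γ, RightmostAt Λ α γ → content s γ ≤ content s (P 0)) ∧
  (∀ γ, RightmostAt Λ α γ → content s γ = content s (P 0) → (P 0).comp ≤ γ.comp) ∧
  ∀ i : ℕ, i + 1 < e →
    content s (P (i + 1)) < content s (P i) ∧
    (∀ γ, RightmostAt Λ α γ → content s γ < content s (P i) →
        content s γ ≤ content s (P (i + 1))) ∧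
    ∀ γ, RightmostAt Λ α γ → content s γ = content s (P (i + 1)) →
        (P (i + 1)).comp ≤ γ.comp

/-- `γ` is one of the nodes of the pseudoperiod `P` (of length `e`). -/
def InPseudo (e : ℕ) (P : ℕ → Node l) (γ : Node l) : Prop := ∃ i, i < e ∧ P i = γ

/-- The number of parts of `π` equal to `v`. -/
noncomputable def countParts (π : Partition) (v : ℕ) : ℕ :=
  Nat.card {a : ℕ // 1 ≤ a ∧ π.part a = v}

/-- `N^{>α}_c`: the number of parts of `Λ^c` greater than `α`. -/
noncomputable def NgtA (Λ : MultiPartition l) (α : ℕ) (c : Fin (l + 1)) : ℕ :=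
  Nat.card {a : ℕ // 1 ≤ a ∧ α < (Λ c).part a}

/-- `N^α_c`: the number of parts of `Λ^c` (equal to `α`) whose rightmost node is in `P`. -/
noncomputable def NalP (e : ℕ) (P : ℕ → Node l) (c : Fin (l + 1)) : ℕ :=
  Nat.card {i : ℕ // i < e ∧ (P i).comp = c}

/-- The number of rows of component `c` above row `r` whose rightmost node is in `P`. -/
noncomputable def PAbove (e : ℕ) (P : ℕ → Node l) (c : Fin (l + 1)) (r : ℕ) : ℕ :=
  Nat.card {i : ℕ // i < e ∧ (P i).comp = c ∧ (P i).row < r}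

/-- `μ = ψ(Λ)`: for each component `C`, `μ^C` consists of the parts of `Λ^C` smaller
than `α`, the parts of `Λ^C` equal to `α` whose rightmost node is not in `P`, and the
parts of `Λ^{C−1}` (cyclically) greater than `α`; specified via part multiplicities. -/
def IsPsi (e : ℕ) (P : ℕ → Node l) (α : ℕ) (Λ μ : MultiPartition l) : Prop :=
  ∀ C : Fin (l + 1), ∀ v : ℕ, 1 ≤ v →
    countParts (μ C) v =
      if v < α then countParts (Λ C) v
      else if v = α then countParts (Λ C) α - NalP e P C
      else countParts (Λ (prevComp C)) v

/-- The canonical association between nodes of `Λ` (outside the rows of `P`) and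
nodes of `ψ(Λ)`: boxes of parts `> α` keep their row and move one component up
(cyclically), boxes of kept parts `≤ α` stay in their component, their row being
shifted by the number of rows removed above minus the number of rows inserted above. -/
def CanonAssoc (e : ℕ) (Λ : MultiPartition l) (α : ℕ) (P : ℕ → Node l)
    (γ Γ : Node l) : Prop :=
  Γ.col = γ.col ∧
  ( (α < (Λ γ.comp).part γ.row ∧ Γ.comp = rho l γ.comp ∧ Γ.row = γ.row)
  ∨ ((Λ γ.comp).part γ.row ≤ α ∧
      (∀ i, i < e → ¬ ((P i).comp = γ.comp ∧ (P i).row = γ.row)) ∧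
      Γ.comp = γ.comp ∧
      Γ.row + NgtA Λ α γ.comp + PAbove e P γ.comp γ.row
        = γ.row + NgtA Λ α (prevComp γ.comp)) )

/-- The entry of the `s`-symbol of `Λ` of size `p` in row `c` and column `k`
(`1 ≤ k ≤ p + s_c`): `b^c_a = λ^c_a − a + p + s_c` with `a = p + s_c − k + 1`. -/
def symbolEntry (s : Fin (l + 1) → ℤ) (Λ : MultiPartition l) (p : ℤ)
    (c : Fin (l + 1)) (k : ℕ) : ℤ :=
  ((Λ c).part (p + s c - (k : ℤ) + 1).toNat : ℤ) - (p + s c - (k : ℤ) + 1) + p + s c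

/-- `p` is an admissible size for the `s`-symbol of `Λ`:
`p ≥ 1 − s_c + h(λ^c)` for all `c`. -/
def SizeOK (s : Fin (l + 1) → ℤ) (Λ : MultiPartition l) (p : ℤ) : Prop :=
  ∀ c, 1 ≤ p + s c ∧ ∀ a : ℕ, p + s c ≤ (a : ℤ) → (Λ c).part a = 0

/-- The `s`-symbol of `Λ` of size `p` is semistandard: `s` is non-decreasing, the
entries in each column are non-decreasing (read from the row with the larger index
down to the row with the smaller one), and the entries in each row are increasing. -/
def SemistandardAt (s : Fin (l + 1) → ℤ) (Λ : MultiPartition l) (p : ℤ) : Prop :=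
  Monotone s ∧
  (∀ c c' : Fin (l + 1), c < c' → ∀ k : ℕ, 1 ≤ k → (k : ℤ) ≤ p + s c →
      symbolEntry s Λ p c' k ≤ symbolEntry s Λ p c k) ∧
  ∀ c, ∀ k : ℕ, 1 ≤ k → (k : ℤ) + 1 ≤ p + s c →
      symbolEntry s Λ p c k < symbolEntry s Λ p c (k + 1)

/-- The `s`-symbol of `Λ` is semistandard (for every admissible size). -/
def Semistandard (s : Fin (l + 1) → ℤ) (Λ : MultiPartition l) : Prop :=
  ∀ p : ℤ, SizeOK s Λ p → SemistandardAt s Λ p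

/-- The index of the column of the symbol of size `p` containing the entry
corresponding to the node `γ`. -/
def colOf (s : Fin (l + 1) → ℤ) (p : ℤ) (γ : Node l) : ℤ :=
  p + s γ.comp - (γ.row : ℤ) + 1


/-- A part of row `a` exceeds `β` iff `a` is at most the number of parts exceeding `β`. -/
theorem lt_part_iff_le_NgtA (Λ : MultiPartition l) (β : ℕ) (c : Fin (l + 1)) {a : ℕ}
    (ha : 1 ≤ a) : β < (Λ c).part a ↔ a ≤ NgtA Λ β c := by
  classical
  have hanti : ∀ a b : ℕ, 1 ≤ a → a ≤ b → (Λ c).part b ≤ (Λ c).part a := by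
    intro a b ha hab
    induction b, hab using Nat.le_induction with
    | base => exact le_rfl
    | succ n hn ih => exact ((Λ c).antitone n (ha.trans hn)).trans ih
  obtain ⟨N, hN⟩ := (Λ c).eventually_zero
  have hex : ∃ n, (Λ c).part (n + 1) ≤ β := ⟨N, by rw [hN _ (by omega)]; omega⟩
  obtain ⟨n, hn, hmin⟩ : ∃ n, (Λ c).part (n + 1) ≤ β ∧ ∀ m < n, β < (Λ c).part (m + 1) :=
    ⟨Nat.find hex, Nat.find_spec hex, fun m hm => not_le.mp (Nat.find_min hex hm)⟩
  have key : ∀ a, 1 ≤ a → (β < (Λ c).part a ↔ a ≤ n) := by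
    intro a ha
    constructor
    · intro h
      by_contra hcon
      have := hanti (n + 1) a (by omega) (by omega)
      omega
    · intro h
      have := hmin (a - 1) (by omega)
      rwa [Nat.sub_add_cancel ha] at this
  have hcard : NgtA Λ β c = n := by
    unfold NgtA
    rw [Nat.subtype_card (Finset.Icc 1 n)]
    · simp
    · intro x
      rw [Finset.mem_Icc]
      exact and_congr_right fun hx => (key x hx).symm
  rw [hcard]
  exact key a ha

/-- Equal multiplicities of all parts greater than `β` give equally many such parts. -/
theorem NgtA_eq_of_countParts_eq (Λ μ : MultiPartition l) (β : ℕ) (c d : Fin (l + 1))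
    (h : ∀ v, β < v → countParts (μ c) v = countParts (Λ d) v) :
    NgtA μ β c = NgtA Λ β d := by
  classical
  let S : MultiPartition l → Fin (l + 1) → Finset ℕ := fun Λ c => Finset.Icc 1 (NgtA Λ β c)
  have hS : ∀ (Λ : MultiPartition l) c a, a ∈ S Λ c ↔ 1 ≤ a ∧ β < (Λ c).part a := by
    intro Λ c a
    rw [Finset.mem_Icc]
    exact and_congr_right fun ha => (lt_part_iff_le_NgtA Λ β c ha).symm
  have hfib : ∀ (Λ : MultiPartition l) c v, β < v →
      countParts (Λ c) v = ((S Λ c).filter fun a => (Λ c).part a = v).card := by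
    intro Λ c v hv
    refine Nat.subtype_card _ fun x => ?_
    rw [Finset.mem_filter, hS]
    constructor
    · rintro ⟨⟨h1, -⟩, h2⟩
      exact ⟨h1, h2⟩
    · rintro ⟨h1, h2⟩
      exact ⟨⟨h1, h2 ▸ hv⟩, h2⟩
  let T : Finset ℕ := (S μ c).image (μ c).part ∪ (S Λ d).image (Λ d).part
  have hT : ∀ v ∈ T, β < v := by
    intro v hv
    rcases Finset.mem_union.mp hv with hv | hv <;>
    · obtain ⟨a, ha, rfl⟩ := Finset.mem_image.mp hv
      exact ((hS _ _ _).mp ha).2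
  have h1 : (S μ c).card = ∑ v ∈ T, ((S μ c).filter fun a => (μ c).part a = v).card :=
    Finset.card_eq_sum_card_fiberwise fun a ha =>
      Finset.mem_union_left _ (Finset.mem_image_of_mem _ ha)
  have h2 : (S Λ d).card = ∑ v ∈ T, ((S Λ d).filter fun a => (Λ d).part a = v).card :=
    Finset.card_eq_sum_card_fiberwise fun a ha =>
      Finset.mem_union_right _ (Finset.mem_image_of_mem _ ha)
  have h3 : (S μ c).card = (S Λ d).card := by
    rw [h1, h2]
    refine Finset.sum_congr rfl fun v hv => ?_
    rw [← hfib _ _ _ (hT v hv), ← hfib _ _ _ (hT v hv), h v (hT v hv)]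
  simpa [S] using h3

theorem prevComp_zero : prevComp (0 : Fin (l + 1)) = Fin.last l := by
  rw [prevComp, Equiv.symm_apply_eq, rho, finRotate_last]

theorem prevComp_succ (c : Fin l) : prevComp c.succ = c.castSucc := by
  rw [prevComp, Equiv.symm_apply_eq, rho, finRotate_apply, Fin.coeSucc_eq_succ]

/-- The charge of component `c` minus the number of its parts exceeding `β`. -/
noncomputable def shiftedCharge (s : Fin (l + 1) → ℤ) (Λ : MultiPartition l) (β : ℕ)
    (c : Fin (l + 1)) : ℤ :=
  s c - NgtA Λ β c

theorem Cylindric.shiftedCharge_monotone {e : ℕ} {s : Fin (l + 1) → ℤ} {Λ : MultiPartition l}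
    (h : Cylindric e s Λ) (hs : InSe e s) (β : ℕ) : Monotone (shiftedCharge s Λ β) := by
  rw [Fin.monotone_iff_le_succ]
  intro c
  have h1 := h.1 c (NgtA Λ β c.castSucc + 1) (by omega)
  have h2 := (lt_part_iff_le_NgtA Λ β c.castSucc (a := NgtA Λ β c.castSucc + 1) (by omega))
  have h3 := (lt_part_iff_le_NgtA Λ β c.succ
    (a := NgtA Λ β c.castSucc + 1 + (s c.succ - s c.castSucc).toNat) (by omega))
  have h4 := (hs c.castSucc c.succ Fin.castSucc_lt_succ).1
  unfold shiftedCharge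
  omega

theorem Cylindric.shiftedCharge_last_le {e : ℕ} {s : Fin (l + 1) → ℤ} {Λ : MultiPartition l}
    (h : Cylindric e s Λ) (hs : InSe e s) (β : ℕ) :
    shiftedCharge s Λ β (Fin.last l) ≤ shiftedCharge s Λ β 0 + e := by
  have h1 := h.2 (NgtA Λ β (Fin.last l) + 1) (by omega)
  have h2 := (lt_part_iff_le_NgtA Λ β (Fin.last l) (a := NgtA Λ β (Fin.last l) + 1) (by omega))
  have h3 := (lt_part_iff_le_NgtA Λ β 0
    (a := NgtA Λ β (Fin.last l) + 1 + ((e : ℤ) + s 0 - s (Fin.last l)).toNat) (by omega))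
  have h4 : s (Fin.last l) - s 0 ≤ e := by
    rcases eq_or_ne (Fin.last l) 0 with h0 | h0
    · rw [h0]; omega
    · exact (hs 0 (Fin.last l) (Fin.pos_of_ne_zero h0)).2.le
  unfold shiftedCharge
  omega

/-- The cyclage of the charge shifted by the number of parts exceeding `β`. -/
noncomputable def xiShiftedCharge (e : ℕ) (s : Fin (l + 1) → ℤ) (Λ : MultiPartition l) (β : ℕ)
    (c : Fin (l + 1)) : ℤ :=
  xiCharge e s c - NgtA Λ β (prevComp c)

theorem xiShiftedCharge_zero (e : ℕ) (s : Fin (l + 1) → ℤ) (Λ : MultiPartition l) (β : ℕ) :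
    xiShiftedCharge e s Λ β 0 = shiftedCharge s Λ β (Fin.last l) - e := by
  have : xiCharge e s 0 = s (prevComp 0) - e := by simp [xiCharge, prevComp]
  rw [xiShiftedCharge, this, prevComp_zero, shiftedCharge]
  ring

theorem xiShiftedCharge_succ (e : ℕ) (s : Fin (l + 1) → ℤ) (Λ : MultiPartition l) (β : ℕ)
    (c : Fin l) : xiShiftedCharge e s Λ β c.succ = shiftedCharge s Λ β c.castSucc := by
  have : xiCharge e s c.succ = s (prevComp c.succ) := by
    simp [xiCharge, prevComp]
  rw [xiShiftedCharge, this, prevComp_succ, shiftedCharge]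

section Cylindric

variable {e : ℕ} {s : Fin (l + 1) → ℤ} {Λ : MultiPartition l}

theorem Cylindric.shiftedCharge_le_xi (h : Cylindric e s Λ) (hs : InSe e s) (β : ℕ)
    {c d : Fin (l + 1)} (hdc : d < c) :
    shiftedCharge s Λ β d ≤ xiShiftedCharge e s Λ β c := by
  obtain ⟨c, rfl⟩ := Fin.exists_succ_eq.mpr (Fin.ne_zero_of_lt hdc)
  rw [xiShiftedCharge_succ]
  exact h.shiftedCharge_monotone hs β (Fin.le_castSucc_iff.mpr hdc)

theorem Cylindric.last_sub_le_xi (h : Cylindric e s Λ) (hs : InSe e s) (β : ℕ)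
    (c : Fin (l + 1)) :
    shiftedCharge s Λ β (Fin.last l) - e ≤ xiShiftedCharge e s Λ β c := by
  rcases eq_or_ne c 0 with rfl | hc
  · rw [xiShiftedCharge_zero]
  · have := h.shiftedCharge_le_xi hs β (Fin.pos_of_ne_zero hc)
    have := h.shiftedCharge_last_le hs β
    omega

theorem Cylindric.xi_le_shiftedCharge (h : Cylindric e s Λ) (hs : InSe e s) (β : ℕ)
    (c : Fin (l + 1)) : xiShiftedCharge e s Λ β c ≤ shiftedCharge s Λ β c := by
  induction c using Fin.cases with
  | zero =>
    rw [xiShiftedCharge_zero]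
    have := h.shiftedCharge_last_le hs β
    omega
  | succ c =>
    rw [xiShiftedCharge_succ]
    exact h.shiftedCharge_monotone hs β Fin.castSucc_lt_succ.le

/-- Every integer in the top window of length `e` lies in the window of some component. -/
theorem exists_xi_le_lt_shiftedCharge (β : ℕ) {y : ℤ}
    (hy : shiftedCharge s Λ β (Fin.last l) - e ≤ y)
    (hc : ∃ c, y < shiftedCharge s Λ β c) :
    ∃ c, xiShiftedCharge e s Λ β c ≤ y ∧ y < shiftedCharge s Λ β c ∧
      ∀ d, y < shiftedCharge s Λ β d → c ≤ d := by
  obtain ⟨c, hc, hmin⟩ := WellFounded.has_min (wellFounded_lt (α := Fin (l + 1)))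
    {c | y < shiftedCharge s Λ β c} hc
  refine ⟨c, ?_, hc, fun d hd => not_lt.mp (hmin d hd)⟩
  induction c using Fin.cases with
  | zero => rwa [xiShiftedCharge_zero]
  | succ c =>
    rw [xiShiftedCharge_succ]
    exact not_lt.mp fun hlt => hmin _ hlt Fin.castSucc_lt_succ

/-- Rightmost nodes of parts of size `α` in terms of their shifted contents. -/
theorem RightmostAt.window {α : ℕ} (hα : 1 ≤ α) {γ : Node l} (h : RightmostAt Λ α γ) :
    shiftedCharge s Λ (α - 1) γ.comp ≤ content s γ - α ∧
      content s γ - α < shiftedCharge s Λ α γ.comp := by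
  obtain ⟨h1, h2, h3⟩ := h
  have h4 := lt_part_iff_le_NgtA Λ α γ.comp h1
  have h5 := lt_part_iff_le_NgtA Λ (α - 1) γ.comp h1
  unfold shiftedCharge content
  omega

theorem exists_rightmostAt {α : ℕ} {c : Fin (l + 1)} {y : ℤ}
    (h1 : shiftedCharge s Λ (α - 1) c ≤ y) (h2 : y < shiftedCharge s Λ α c) :
    ∃ γ : Node l, RightmostAt Λ α γ ∧ γ.comp = c ∧ content s γ = y + α := by
  unfold shiftedCharge at h1 h2
  have h3 : 1 ≤ (s c - y).toNat := by omega
  have h4 := lt_part_iff_le_NgtA Λ α c h3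
  have h5 := lt_part_iff_le_NgtA Λ (α - 1) c h3
  refine ⟨⟨(s c - y).toNat, α, c⟩, ⟨h3, rfl, ?_⟩, rfl, ?_⟩
  · change (Λ c).part (s c - y).toNat = α
    omega
  · simp only [content]
    omega

/-- If the parts of size `α` cover all residues, the window of each component is filled. -/
theorem Cylindric.shiftedCharge_le_of_covers (h : Cylindric e s Λ) (hs : InSe e s) (he : 1 ≤ e)
    {α : ℕ} (hα : 1 ≤ α) (hcov : Covers e s Λ α) {c : Fin (l + 1)} {y : ℤ}
    (hy : xiShiftedCharge e s Λ α c ≤ y) : shiftedCharge s Λ (α - 1) c ≤ y := by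
  have he' : (0 : ℤ) < e := by omega
  obtain ⟨γ, hγ, hres⟩ := hcov ((y + α) % e) (Int.emod_nonneg _ he'.ne') (Int.emod_lt_of_pos _ he')
  obtain ⟨k, hk⟩ := (Int.ModEq.symm hres).dvd
  obtain ⟨h3, h4⟩ := hγ.window (s := s) hα
  have hF := h.shiftedCharge_monotone hs α (Fin.le_last γ.comp)
  have hG := h.shiftedCharge_monotone hs (α - 1)
  have hl := h.last_sub_le_xi hs α c
  rcases lt_trichotomy k 0 with hk0 | rfl | hk0
  · have := hG (Fin.le_last c)
    have := hG (Fin.zero_le γ.comp)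
    have := h.shiftedCharge_last_le hs (α - 1)
    nlinarith
  · have hle : c ≤ γ.comp := by
      by_contra hlt
      have := h.shiftedCharge_le_xi hs α (not_le.mp hlt)
      omega
    have := hG hle
    omega
  · nlinarith

variable {α : ℕ} {P : ℕ → Node l}

/-- The nodes of the first pseudoperiod have consecutive contents. -/
theorem IsFirstPseudoperiod.content_eq (hP : IsFirstPseudoperiod e s Λ α P)
    (h : Cylindric e s Λ) (hs : InSe e s) {i : ℕ} (hi : i < e) :
    content s (P i) - α = shiftedCharge s Λ α (Fin.last l) - 1 - i := by
  obtain ⟨hα, hcov, -, hR, hmax, -, hstep⟩ := hP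
  have hnode : ∀ j : ℕ, j < e → ∃ γ, RightmostAt Λ α γ ∧
      content s γ = shiftedCharge s Λ α (Fin.last l) - 1 - j + α := by
    intro j hj
    obtain ⟨c, h1, h2, -⟩ := exists_xi_le_lt_shiftedCharge (e := e) (s := s) (Λ := Λ) α
      (y := shiftedCharge s Λ α (Fin.last l) - 1 - j) (by omega) ⟨Fin.last l, by omega⟩
    obtain ⟨γ, hγ, -, hc⟩ := exists_rightmostAt
      (h.shiftedCharge_le_of_covers hs (by omega) hα hcov h1) h2
    exact ⟨γ, hγ, hc⟩
  induction i with
  | zero =>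
    obtain ⟨γ, hγ, hc⟩ := hnode 0 hi
    have h1 := hmax γ hγ
    have h2 := ((hR 0 hi).window (s := s) hα).2
    have h3 := h.shiftedCharge_monotone hs α (Fin.le_last (P 0).comp)
    push_cast at hc ⊢
    omega
  | succ i ih =>
    have ih := ih (by omega)
    obtain ⟨γ, hγ, hc⟩ := hnode (i + 1) hi
    obtain ⟨h1, h2, -⟩ := hstep i hi
    have h3 := h2 γ hγ (by push_cast at hc; omega)
    push_cast at hc ⊢
    omega

theorem IsFirstPseudoperiod.comp_le (hP : IsFirstPseudoperiod e s Λ α P) {i : ℕ} (hi : i < e)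
    {γ : Node l} (hγ : RightmostAt Λ α γ) (hc : content s γ = content s (P i)) :
    (P i).comp ≤ γ.comp := by
  obtain ⟨-, -, -, -, -, hzero, hstep⟩ := hP
  cases i with
  | zero => exact hzero γ hγ hc
  | succ i => exact (hstep i hi).2.2 γ hγ hc

/-- The component of a node of the first pseudoperiod is determined by its content. -/
theorem IsFirstPseudoperiod.comp_eq_iff (hP : IsFirstPseudoperiod e s Λ α P)
    (h : Cylindric e s Λ) (hs : InSe e s) {i : ℕ} (hi : i < e) (c : Fin (l + 1)) :
    (P i).comp = c ↔ xiShiftedCharge e s Λ α c ≤ content s (P i) - α ∧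
      content s (P i) - α < shiftedCharge s Λ α c := by
  have hfill := fun {c y} => h.shiftedCharge_le_of_covers hs (c := c) (y := y)
    (by omega) hP.1 hP.2.1
  have hcont := hP.content_eq h hs hi
  have hw := ((hP.2.2.2.1 i hi).window (s := s) hP.1).2
  constructor
  · rintro rfl
    obtain ⟨d, h1, h2, hmin⟩ := exists_xi_le_lt_shiftedCharge (e := e) (s := s) (Λ := Λ) α
      (y := content s (P i) - α) (by omega) ⟨_, hw⟩
    obtain ⟨γ, hγ, rfl, hc⟩ := exists_rightmostAt (hfill h1) h2
    have heq := le_antisymm (hP.comp_le hi hγ (by omega)) (hmin _ hw)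
    exact ⟨heq ▸ h1, hw⟩
  · rintro ⟨h1, h2⟩
    obtain ⟨γ, hγ, rfl, hc⟩ := exists_rightmostAt (hfill h1) h2
    refine (hP.comp_le hi hγ (by omega)).eq_of_not_lt fun hlt => ?_
    have := h.shiftedCharge_le_xi hs α hlt
    omega

/-- A row outside the first pseudoperiod with part at most `α` lies below all the rows
of the pseudoperiod in its component. -/
theorem IsFirstPseudoperiod.sub_row_lt_xi (hP : IsFirstPseudoperiod e s Λ α P)
    (h : Cylindric e s Λ) (hs : InSe e s) {c : Fin (l + 1)} {r : ℕ} (hr : 1 ≤ r)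
    (hle : (Λ c).part r ≤ α) (hnot : ∀ i, i < e → ¬ ((P i).comp = c ∧ (P i).row = r)) :
    s c - r < xiShiftedCharge e s Λ α c := by
  by_contra hcon
  rw [not_lt] at hcon
  have h1 := h.last_sub_le_xi hs α c
  have h2 : s c - r < shiftedCharge s Λ α c := by
    have := lt_part_iff_le_NgtA Λ α c hr
    unfold shiftedCharge
    omega
  have h3 := h.shiftedCharge_monotone hs α (Fin.le_last c)
  obtain ⟨i, hi⟩ := Int.eq_ofNat_of_zero_le
    (show 0 ≤ shiftedCharge s Λ α (Fin.last l) - 1 - (s c - r) by omega)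
  have hie : i < e := by omega
  have hcont := hP.content_eq h hs hie
  have hcomp := (hP.comp_eq_iff h hs hie c).mpr ⟨by omega, by omega⟩
  refine hnot i hie ⟨hcomp, ?_⟩
  have hcol := (hP.2.2.2.1 i hie).2.1
  rw [content, hcomp, hcol] at hcont
  omega

/-- The number of pseudoperiod rows above a kept row of a part at most `α`. -/
theorem IsFirstPseudoperiod.PAbove_eq (hP : IsFirstPseudoperiod e s Λ α P)
    (h : Cylindric e s Λ) (hs : InSe e s) {c : Fin (l + 1)} {r : ℕ}
    (hlt : s c - r < xiShiftedCharge e s Λ α c) :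
    (PAbove e P c r : ℤ) = shiftedCharge s Λ α c - xiShiftedCharge e s Λ α c := by
  have h1 := h.last_sub_le_xi hs α c
  have h2 := h.xi_le_shiftedCharge hs α c
  have h3 := h.shiftedCharge_monotone hs α (Fin.le_last c)
  set L := shiftedCharge s Λ α (Fin.last l) with hL
  have hcard : PAbove e P c r = (Finset.Ico (L - shiftedCharge s Λ α c).toNat
      (L - xiShiftedCharge e s Λ α c).toNat).card := by
    refine Nat.subtype_card _ fun i => ?_
    rw [Finset.mem_Ico]
    constructor
    · intro hi
      have hie : i < e := by omega
      have hcont := hP.content_eq h hs hie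
      have hcomp := (hP.comp_eq_iff h hs hie c).mpr ⟨by omega, by omega⟩
      refine ⟨hie, hcomp, ?_⟩
      have hcol := (hP.2.2.2.1 i hie).2.1
      rw [content, hcomp, hcol] at hcont
      omega
    · rintro ⟨hie, hcomp, -⟩
      have hcont := hP.content_eq h hs hie
      have := (hP.comp_eq_iff h hs hie c).mp hcomp
      omega
  rw [hcard, Nat.card_Ico]
  omega

end Cylindric

/-!
STATEMENT 14: for μ = ψ(λ) charged by ξ(s), canonically associated nodes have the same
content, except for the nodes of μ lying in parts > α of the first component, whose
content is the content of the associated node of λ minus e.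
-/
theorem reduction_preserves_contents
    (l e : ℕ) (he : 2 ≤ e) (s : Fin (l + 1) → ℤ) (Λ μ : MultiPartition l)
    (α : ℕ) (P : ℕ → Node l)
    (hs : InSe e s) (hcyl : Cylindric e s Λ) (hnf : ¬ FLOTW e s Λ)
    (hP : IsFirstPseudoperiod e s Λ α P)
    (hμ : IsPsi e P α Λ μ) :
    ∀ γ Γ : Node l, IsNode Λ γ → IsNode μ Γ → CanonAssoc e Λ α P γ Γ →
      ((α < (μ Γ.comp).part Γ.row →
          ((Γ.comp ≠ 0 → content (xiCharge e s) Γ = content s γ) ∧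
           (Γ.comp = 0 → content (xiCharge e s) Γ = content s γ - e))) ∧
       ((μ Γ.comp).part Γ.row ≤ α → content (xiCharge e s) Γ = content s γ)) := by
  have hN : ∀ C, NgtA μ α C = NgtA Λ α (prevComp C) := fun C =>
    NgtA_eq_of_countParts_eq Λ μ α C (prevComp C) fun v hv => by
      rw [hμ C v (by omega), if_neg (by omega), if_neg (by omega)]
  intro γ Γ hγ hΓ hassoc
  have hpart := lt_part_iff_le_NgtA μ α Γ.comp hΓ.1
  rw [hN] at hpart
  obtain ⟨hcol, ⟨hlt, hcomp, hrow⟩ | ⟨hle, hnot, hcomp, hrow⟩⟩ := hassoc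
  · have hprev : prevComp Γ.comp = γ.comp := by rw [hcomp, prevComp, Equiv.symm_apply_apply]
    have hlt' := (lt_part_iff_le_NgtA Λ α γ.comp hγ.1).mp hlt
    rw [hprev, hrow] at hpart
    have hxi : xiCharge e s Γ.comp = s γ.comp - if Γ.comp = 0 then (e : ℤ) else 0 := by
      rw [← hprev]
      rfl
    refine ⟨fun _ => ⟨fun h0 => ?_, fun h0 => ?_⟩, fun hle => ?_⟩
    · rw [content, hxi, if_neg h0, hcol, hrow, content, sub_zero]
    · rw [content, hxi, if_pos h0, hcol, hrow, content]
      ring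
    · rw [hrow] at hle
      omega
  · have hlt := hP.sub_row_lt_xi hcyl hs hγ.1 hle hnot
    have hPA := hP.PAbove_eq hcyl hs hlt
    rw [hcomp] at hpart
    unfold xiShiftedCharge at hlt hPA
    unfold shiftedCharge at hPA
    refine ⟨fun hgt => ?_, fun _ => ?_⟩
    · rw [hcomp] at hgt
      omega
    · rw [content, content, hcomp, hcol]
      omega

end FockCrystal
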